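/- arXiv:0704.3633 — 2 statements merged into one kernel-verified Lean document; each statement's English description precedes it below -/
import Mathlib

section
/- Let 𝒯 be a pretriangulated category admitting arbitrary (small) coproducts, and let S be an object of 𝒯. The following are equivalent: (1) (global generating hypothesis) for every morphism f : X ⟶ Y in 𝒯, if g ≫ f = 0 for every n ∈ ℤ and every morphism g : S⟦n⟧ ⟶ X, then f = 0; (2) every object of 𝒯 is a retract of a coproduct of objects of the form S⟦n⟧ with n ∈ ℤ. -/
open CategoryTheory CategoryTheory.Limits

universe v u

/-- Let `𝒯` be a pretriangulated category with arbitrary small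
coproducts and `S` an object of `𝒯`.  Then the global generating hypothesis — every
morphism `f : X ⟶ Y` with `g ≫ f = 0` for all `g : S⟦n⟧ ⟶ X`, `n ∈ ℤ`, is zero — holds
if and only if every object of `𝒯` is a retract of a coproduct of shifts of `S`. -/
theorem global_generating_hypothesis_iff_retract_of_coproduct
    (C : Type u) [Category.{v} C] [Preadditive C] [HasZeroObject C] [HasShift C ℤ]
    [∀ n : ℤ, (shiftFunctor C n).Additive] [Pretriangulated C]
    [HasCoproducts.{v} C] (S : C) :
    (∀ ⦃X Y : C⦄ (f : X ⟶ Y), (∀ (n : ℤ) (g : S⟦n⟧ ⟶ X), g ≫ f = 0) → f = 0) ↔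
    (∀ X : C, ∃ (ι : Type v) (e : ι → ℤ) (i : X ⟶ ∐ fun j => S⟦e j⟧)
      (r : (∐ fun j => S⟦e j⟧) ⟶ X), i ≫ r = 𝟙 X) := by
  constructor
  · intro h X
    let p : (∐ fun j : (n : ℤ) × (S⟦n⟧ ⟶ X) => S⟦j.1⟧) ⟶ X := Sigma.desc fun j => j.2
    have : Epi p := Preadditive.epi_of_cancel_zero p fun f hf => h f fun n g => by
      have hg : Sigma.ι (fun j : (n : ℤ) × (S⟦n⟧ ⟶ X) => S⟦j.1⟧) ⟨n, g⟩ ≫ p = g :=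
        Sigma.ι_desc _ _
      rw [← hg, Category.assoc, hf, comp_zero]
    have : IsSplitEpi p := isSplitEpi_of_epi p
    exact ⟨(n : ℤ) × (S⟦n⟧ ⟶ X), fun j => j.1, section_ p, p, IsSplitEpi.id p⟩
  · intro h X Y f hf
    obtain ⟨ι, e, i, r, hir⟩ := h X
    have hr : r ≫ f = 0 := Sigma.hom_ext _ _ fun j => by
      rw [← Category.assoc, hf, comp_zero]
    rw [← Category.id_comp f, ← hir, Category.assoc, hr, comp_zero]
end

section
/- Let 𝒯 be a pretriangulated category admitting arbitrary (small) coproducts, and let S be a compact object of 𝒯, meaning that for every small family of objects (Xᵢ) the canonical map ⨁ᵢ Hom(S, Xᵢ) → Hom(S, ∐ᵢ Xᵢ) is bijective. Let thick⟨S⟩ denote the smallest strictly full triangulated subcategory of 𝒯 containing S and closed under direct summands. Then the following are equivalent: (1) (strong generating hypothesis) for every object X in thick⟨S⟩, every object Y of 𝒯, and every morphism f : X ⟶ Y, if g ≫ f = 0 for every n ∈ ℤ and every g : S⟦n⟧ ⟶ X, then f = 0; (2) every object of thick⟨S⟩ is a retract of a finite coproduct of objects of the form S⟦n⟧ with n ∈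 ℤ. -/
open CategoryTheory CategoryTheory.Limits CategoryTheory.Pretriangulated DirectSum

universe v u

variable (C : Type u) [Category.{v} C] [Preadditive C] [HasZeroObject C] [HasShift C ℤ]
  [∀ n : ℤ, (shiftFunctor C n).Additive] [Pretriangulated C]

/-- Membership in `thick⟨S⟩`, the smallest strictly full triangulated subcategory of `C`
containing `S` and closed under direct summands: the closure of `{S}` under containing the
zero objects, shifts, cones of distinguished triangles and retracts (the latter giving
closure under isomorphisms and direct summands). -/
inductive ThickMem (S : C) : C → Prop
  | base : ThickMem S S
  | zero (X : C) : IsZero X → ThickMem S X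
  | shift (X : C) (n : ℤ) : ThickMem S X → ThickMem S (X⟦n⟧)
  | cone (T : Triangle C) : T ∈ (distTriang C) →
      ThickMem S T.obj₁ → ThickMem S T.obj₂ → ThickMem S T.obj₃
  | retract (X Y : C) (i : X ⟶ Y) (r : Y ⟶ X) : i ≫ r = 𝟙 X →
      ThickMem S Y → ThickMem S X

universe w

namespace CategoryTheory.Limits

open Classical in
/-- The idempotent endomorphism of a coproduct projecting onto the summands indexed by `J`. -/
noncomputable def sigmaTruncation {C : Type*} [Category* C] [Preadditive C] {ι : Type*}
    (Y : ι → C) [HasCoproduct Y] (J : Finset ι) : ∐ Y ⟶ ∐ Y :=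
  Sigma.desc fun j => if j ∈ J then Sigma.ι Y j else 0

section

variable {C : Type*} [Category* C] [Preadditive C] {ι : Type*} {Y : ι → C} [HasCoproduct Y]

lemma ι_sigmaTruncation_of_mem {J : Finset ι} {j : ι} (hj : j ∈ J) :
    Sigma.ι Y j ≫ sigmaTruncation Y J = Sigma.ι Y j := by
  simp [sigmaTruncation, hj]

lemma ι_sigmaTruncation_of_notMem {J : Finset ι} {j : ι} (hj : j ∉ J) :
    Sigma.ι Y j ≫ sigmaTruncation Y J = 0 := by
  simp [sigmaTruncation, hj]

lemma sigmaTruncation_comp_of_subset {J K : Finset ι} (h : J ⊆ K) :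
    sigmaTruncation Y J ≫ sigmaTruncation Y K = sigmaTruncation Y J := by
  refine Sigma.hom_ext _ _ fun j => ?_
  by_cases hj : j ∈ J
  · rw [← Category.assoc, ι_sigmaTruncation_of_mem hj, ι_sigmaTruncation_of_mem (h hj)]
  · rw [← Category.assoc, ι_sigmaTruncation_of_notMem hj, zero_comp]

lemma comp_sigmaTruncation_of_subset {J K : Finset ι} (h : J ⊆ K) {X : C} {f : X ⟶ ∐ Y}
    (hf : f ≫ sigmaTruncation Y J = f) : f ≫ sigmaTruncation Y K = f := by
  rw [← hf, Category.assoc, sigmaTruncation_comp_of_subset h]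

open Classical in
lemma sigmaTruncation_eq_sum (J : Finset ι) :
    sigmaTruncation Y J = ∑ j ∈ J, Sigma.π Y j ≫ Sigma.ι Y j := by
  refine Sigma.hom_ext _ _ fun j => ?_
  rw [Preadditive.comp_sum]
  by_cases hj : j ∈ J
  · rw [ι_sigmaTruncation_of_mem hj, Finset.sum_eq_single_of_mem j hj]
    · simp
    · intro k _ hk
      rw [Sigma.ι_π_of_ne_assoc _ hk.symm, zero_comp]
  · rw [ι_sigmaTruncation_of_notMem hj, Finset.sum_eq_zero]
    intro k hk
    rw [Sigma.ι_π_of_ne_assoc _ (by rintro rfl; exact hj hk), zero_comp]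

/-- The truncation to `J` factors through the coproduct of the summands indexed by `J`. -/
lemma exists_comp_desc_eq_sigmaTruncation (J : Finset ι) [HasCoproduct fun j : J => Y j] :
    ∃ q : ∐ Y ⟶ ∐ fun j : J => Y j,
      q ≫ Sigma.desc (fun j : J => Sigma.ι Y j) = sigmaTruncation Y J := by
  classical
  refine ⟨Sigma.desc fun j => if hj : j ∈ J then
    Sigma.ι (fun j : J => Y j) ⟨j, hj⟩ else 0, Sigma.hom_ext _ _ fun j => ?_⟩
  by_cases hj : j ∈ J
  · simp [ι_sigmaTruncation_of_mem hj, hj]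
  · simp [ι_sigmaTruncation_of_notMem hj, hj]

/-- The morphisms `X ⟶ Z` that are finite sums of morphisms factoring through some `a j`. -/
def finiteSums {Y : ι → C} (X : C) {Z : C} (a : ∀ j, Y j ⟶ Z) : AddSubgroup (X ⟶ Z) :=
  AddSubgroup.closure {f | ∃ (j : ι) (g : X ⟶ Y j), g ≫ a j = f}

lemma comp_mem_finiteSums {Y : ι → C} {X Z : C} {a : ∀ j, Y j ⟶ Z} {j : ι} (g : X ⟶ Y j) :
    g ≫ a j ∈ finiteSums X a :=
  AddSubgroup.subset_closure ⟨j, g, rfl⟩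

lemma mem_finiteSums_iff {X : C} {f : X ⟶ ∐ Y} :
    f ∈ finiteSums X (Sigma.ι Y) ↔ ∃ J : Finset ι, f ≫ sigmaTruncation Y J = f := by
  classical
  refine ⟨fun hf => ?_, fun ⟨J, hJ⟩ => ?_⟩
  · induction hf using AddSubgroup.closure_induction with
    | mem f hf =>
      obtain ⟨j, g, rfl⟩ := hf
      exact ⟨{j}, by rw [Category.assoc, ι_sigmaTruncation_of_mem (Finset.mem_singleton_self j)]⟩
    | zero => exact ⟨∅, zero_comp⟩
    | add f g _ _ hf hg =>
      obtain ⟨J, hJ⟩ := hf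
      obtain ⟨K, hK⟩ := hg
      exact ⟨J ∪ K, by rw [Preadditive.add_comp,
        comp_sigmaTruncation_of_subset Finset.subset_union_left hJ,
        comp_sigmaTruncation_of_subset Finset.subset_union_right hK]⟩
    | neg f _ hf =>
      obtain ⟨J, hJ⟩ := hf
      exact ⟨J, by rw [Preadditive.neg_comp, hJ]⟩
  · rw [← hJ, sigmaTruncation_eq_sum, Preadditive.comp_sum]
    refine sum_mem fun j _ => ?_
    rw [← Category.assoc]
    exact comp_mem_finiteSums _

end

/-- Every morphism from `X` to a coproduct indexed by a type in `Type w` is a finite sum of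
morphisms factoring through the summands. -/
def MapsToFiniteSums {C : Type*} [Category* C] [Preadditive C] [HasCoproducts.{w} C]
    (X : C) : Prop :=
  ∀ ⦃ι : Type w⦄ (Y : ι → C) (f : X ⟶ ∐ Y), f ∈ finiteSums X (Sigma.ι Y)

namespace MapsToFiniteSums

variable {C : Type*} [Category* C] [Preadditive C] [HasCoproducts.{w} C]

lemma of_isZero {X : C} (hX : IsZero X) : MapsToFiniteSums.{w} X := fun _ _ f => by
  rw [hX.eq_of_src f 0]
  exact zero_mem _

lemma of_retract {X Y : C} {i : X ⟶ Y} {r : Y ⟶ X} (h : i ≫ r = 𝟙 X)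
    (hY : MapsToFiniteSums.{w} Y) : MapsToFiniteSums.{w} X := fun _ Z f => by
  obtain ⟨J, hJ⟩ := mem_finiteSums_iff.1 (hY Z (r ≫ f))
  refine mem_finiteSums_iff.2 ⟨J, ?_⟩
  simpa [reassoc_of% h] using i ≫= hJ

lemma of_adjunction {F G : C ⥤ C} [G.Additive] [F.Additive] (adj : F ⊣ G)
    [PreservesColimitsOfSize.{w, w} G] {X : C}
    (hX : MapsToFiniteSums.{w} X) : MapsToFiniteSums.{w} (F.obj X) := fun ι Y f => by
  have key : ∀ k ∈ finiteSums X (Sigma.ι fun j => G.obj (Y j)),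
      (adj.homEquiv _ _).symm (k ≫ sigmaComparison G Y) ∈ finiteSums (F.obj X) (Sigma.ι Y) := by
    intro k hk
    rw [Adjunction.homEquiv_counit]
    induction hk using AddSubgroup.closure_induction with
    | mem k hk =>
      obtain ⟨j, g, rfl⟩ := hk
      have : F.map ((g ≫ Sigma.ι (fun j => G.obj (Y j)) j) ≫ sigmaComparison G Y) ≫
          adj.counit.app _ = (F.map g ≫ adj.counit.app _) ≫ Sigma.ι Y j := by
        simp [ι_comp_sigmaComparison]
      rw [this]
      exact comp_mem_finiteSums _
    | zero => simp [zero_mem]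
    | add k l _ _ hk hl => simpa using add_mem hk hl
    | neg k _ hk => simpa using hk
  simpa using key _ (hX _ (adj.homEquiv _ _ f ≫ inv (sigmaComparison G Y)))

variable [HasShift C ℤ] [∀ n : ℤ, (shiftFunctor C n).Additive]

lemma shift {X : C} (hX : MapsToFiniteSums.{w} X) (n : ℤ) : MapsToFiniteSums.{w} (X⟦n⟧) :=
  haveI : (shiftEquiv C n).inverse.Additive :=
    inferInstanceAs (shiftFunctor C (-n)).Additive
  haveI : (shiftEquiv C n).functor.Additive :=
    inferInstanceAs (shiftFunctor C n).Additive
  of_adjunction (shiftEquiv C n).toAdjunction hX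

lemma of_distTriang [HasZeroObject C] [Pretriangulated C] {T : Triangle C} (hT : T ∈ distTriang C)
    (h₁ : MapsToFiniteSums.{w} T.obj₁) (h₂ : MapsToFiniteSums.{w} T.obj₂) :
    MapsToFiniteSums.{w} T.obj₃ := fun ι Y f => by
  obtain ⟨J, hJ⟩ := mem_finiteSums_iff.1 (h₂ Y (T.mor₂ ≫ f))
  obtain ⟨k, hk⟩ := Triangle.yoneda_exact₃ T hT (f - f ≫ sigmaTruncation Y J) (by
    rw [Preadditive.comp_sub, ← Category.assoc, hJ, sub_self])
  obtain ⟨K, hK⟩ := mem_finiteSums_iff.1 (h₁.shift 1 Y k)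
  have hd : f - f ≫ sigmaTruncation Y J ∈ finiteSums T.obj₃ (Sigma.ι Y) :=
    mem_finiteSums_iff.2 ⟨K, by rw [hk, Category.assoc, hK]⟩
  have he : f ≫ sigmaTruncation Y J ∈ finiteSums T.obj₃ (Sigma.ι Y) :=
    mem_finiteSums_iff.2 ⟨J, by
      rw [Category.assoc, sigmaTruncation_comp_of_subset subset_rfl]⟩
  simpa using add_mem hd he

end MapsToFiniteSums

end CategoryTheory.Limits

lemma ThickMem.mapsToFiniteSums {C : Type u} [Category.{v} C] [Preadditive C] [HasZeroObject C]
    [HasShift C ℤ] [∀ n : ℤ, (shiftFunctor C n).Additive] [Pretriangulated C]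
    [HasCoproducts.{w} C] {S X : C} (hX : ThickMem C S X) (hS : MapsToFiniteSums.{w} S) :
    MapsToFiniteSums.{w} X := by
  induction hX with
  | base => exact hS
  | zero X hX => exact .of_isZero hX
  | shift X n _ hX => exact hX.shift n
  | cone T hT _ _ h₁ h₂ => exact .of_distTriang hT h₁ h₂
  | retract X Y i r h _ hY => exact .of_retract h hY

/-- Let `𝒯` be a pretriangulated category with arbitrary small
coproducts and `S` a compact object (the canonical map `⨁ᵢ Hom(S, Xᵢ) → Hom(S, ∐ᵢ Xᵢ)` is
bijective for every small family `(Xᵢ)`).  Then the strong generating hypothesis — every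
morphism `f : X ⟶ Y` with `X ∈ thick⟨S⟩` such that `g ≫ f = 0` for all `g : S⟦n⟧ ⟶ X`,
`n ∈ ℤ`, is zero — holds if and only if every object of `thick⟨S⟩` is a retract of a
finite coproduct of shifts of `S`. -/
theorem strong_generating_hypothesis_iff_retract_of_finite_coproduct
    [HasCoproducts.{v} C] (S : C)
    (hS : ∀ (ι : Type v) [DecidableEq ι] (X : ι → C),
      Function.Bijective
        ⇑(DirectSum.toAddMonoid
          (fun i => AddMonoidHom.mk' (fun g : S ⟶ X i => g ≫ Sigma.ι X i)
            (fun g g' => Preadditive.add_comp _ _ _ g g' _)) :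
          (⨁ i, (S ⟶ X i)) →+ (S ⟶ ∐ X))) :
    (∀ (X : C), ThickMem C S X → ∀ (Y : C) (f : X ⟶ Y),
        (∀ (n : ℤ) (g : S⟦n⟧ ⟶ X), g ≫ f = 0) → f = 0) ↔
    (∀ X : C, ThickMem C S X →
      ∃ (ι : Type v) (_ : Finite ι) (e : ι → ℤ) (i : X ⟶ ∐ fun j => S⟦e j⟧)
        (r : (∐ fun j => S⟦e j⟧) ⟶ X), i ≫ r = 𝟙 X) := by
  constructor
  · intro H X hX
    have hS' : MapsToFiniteSums.{v} S := fun ι Y f => by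
      classical
      obtain ⟨d, rfl⟩ := (hS ι Y).2 f
      induction d using DirectSum.induction_on with
      | zero => rw [map_zero]; exact zero_mem _
      | of j g =>
        rw [DirectSum.toAddMonoid_of]
        exact comp_mem_finiteSums _
      | add d e hd he => rw [map_add]; exact add_mem hd he
    let A := Σ n : ℤ, (S⟦n⟧ ⟶ X)
    let W : A → C := fun a => S⟦a.1⟧
    let p : ∐ W ⟶ X := Sigma.desc fun a => a.2
    obtain ⟨Y, f, δ, hT⟩ := distinguished_cocone_triangle p
    have hpf : p ≫ f = 0 := comp_distTriang_mor_zero₁₂ _ hT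
    have hf : f = 0 := H X hX Y f fun n g => by
      have hg : Sigma.ι W ⟨n, g⟩ ≫ p = g := Sigma.ι_desc _ _
      rw [← hg, Category.assoc, hpf, comp_zero]
    obtain ⟨s, hs⟩ : ∃ s : X ⟶ ∐ W, 𝟙 X = s ≫ p :=
      Triangle.coyoneda_exact₂ _ hT (𝟙 X) ((Category.id_comp f).trans hf)
    obtain ⟨J, hJ⟩ := mem_finiteSums_iff.1 (hX.mapsToFiniteSums hS' W s)
    obtain ⟨q, hq⟩ := exists_comp_desc_eq_sigmaTruncation (Y := W) J
    have hr : (s ≫ q) ≫ Sigma.desc (fun j : J => Sigma.ι W j) ≫ p = 𝟙 X := by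
      rw [Category.assoc, reassoc_of% hq, reassoc_of% hJ, hs]
    exact ⟨J, inferInstance, fun j => j.1.1, s ≫ q, _, hr⟩
  · intro H X hX Y f hf
    obtain ⟨ι, _, e, i, r, hir⟩ := H X hX
    have hrf : r ≫ f = 0 := Sigma.hom_ext _ _ fun j => by
      rw [← Category.assoc, hf, comp_zero]
    rw [← Category.id_comp f, ← hir, Category.assoc, hrf, comp_zero]
end
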